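/- Let Y be a real-valued random variable with E[exp(−γY)] < ∞ for all γ ∈ [λ_-, λ_+], where λ_- ≤ 0 ≤ λ_+ and λ_- < λ_+, so that the characteristic function Φ(ξ) = E[exp(iξY)] extends analytically to the interior of the strip S_{[λ_-,λ_+]} = {ξ ∈ ℂ : Im ξ ∈ [λ_-, λ_+]} and continuously to the strip. Then for every q ∈ (0,1) there exist μ_- ∈ [λ_-, 0] and μ_+ ∈ [0, λ_+] with μ_- < μ_+, and a constant c > 0, such that Re(1 − qΦ(ξ)) ≥ c for all ξ ∈ S_{[μ_-,μ_+]}. -/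

import Mathlib

open MeasureTheory

/-- The characteristic function of `Y`, extended to complex arguments:
`Φ(ξ) = E[exp(iξY)]`. -/
noncomputable def charFn {Ω : Type*} [MeasurableSpace Ω] (μ : Measure Ω) (Y : Ω → ℝ)
    (ξ : ℂ) : ℂ :=
  ∫ ω, Complex.exp (Complex.I * ξ * Y ω) ∂μ

lemma exp_mul_le_one_add_mul_exp {t : ℝ} (ht0 : 0 ≤ t) (ht1 : t ≤ 1) (x : ℝ) :
    Real.exp (t * x) ≤ 1 + t * Real.exp x := by
  have h := convexOn_exp.2 (Set.mem_univ 0) (Set.mem_univ x) (sub_nonneg.2 ht1) ht0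
    (sub_add_cancel 1 t)
  simp only [smul_eq_mul, mul_zero, zero_add, Real.exp_zero, mul_one] at h
  linarith

/-- On the strip scaled by `t ∈ [0, 1]`, the exponential weight is at most `1` plus `t` times the
sum of the weights at the two edges of the original strip. -/
lemma exp_neg_mul_le_of_mem_Icc {t a b γ : ℝ} (ht0 : 0 ≤ t) (ht1 : t ≤ 1)
    (hγ : γ ∈ Set.Icc (t * a) (t * b)) (y : ℝ) :
    Real.exp (-γ * y) ≤ 1 + t * (Real.exp (-a * y) + Real.exp (-b * y)) := by
  have ha := mul_nonneg ht0 (Real.exp_nonneg (-a * y))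
  have hb := mul_nonneg ht0 (Real.exp_nonneg (-b * y))
  rcases le_total 0 y with hy | hy
  · have h : -γ * y ≤ t * (-a * y) := by
      linarith [mul_le_mul_of_nonneg_right hγ.1 hy]
    linarith [Real.exp_le_exp.2 h, exp_mul_le_one_add_mul_exp ht0 ht1 (-a * y)]
  · have h : -γ * y ≤ t * (-b * y) := by
      linarith [mul_le_mul_of_nonpos_right hγ.2 hy]
    linarith [Real.exp_le_exp.2 h, exp_mul_le_one_add_mul_exp ht0 ht1 (-b * y)]

lemma norm_charFn_le {Ω : Type*} [MeasurableSpace Ω] (μ : Measure Ω) (Y : Ω → ℝ) (ξ : ℂ) :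
    ‖charFn μ Y ξ‖ ≤ ∫ ω, Real.exp (-ξ.im * Y ω) ∂μ := by
  refine (norm_integral_le_integral_norm _).trans_eq ?_
  simp [Complex.norm_exp]

/-- If `E[exp(−γY)] < ∞` for every `γ ∈ [λ₋, λ₊]` (with `λ₋ ≤ 0 ≤ λ₊`, `λ₋ < λ₊`), then for
every `q ∈ (0,1)` there exist `μ₋ ∈ [λ₋, 0]` and `μ₊ ∈ [0, λ₊]` with `μ₋ < μ₊`, and `c > 0`,
such that `Re(1 − qΦ(ξ)) ≥ c` for all `ξ` in the strip `Im ξ ∈ [μ₋, μ₊]`. -/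
theorem lower_bound_re_one_sub_q_charFn
    {Ω : Type*} [MeasurableSpace Ω] (μ : Measure Ω) [IsProbabilityMeasure μ]
    (Y : Ω → ℝ) (hY : Measurable Y)
    (lm lp : ℝ) (hlm : lm ≤ 0) (hlp : 0 ≤ lp) (hlt : lm < lp)
    (hint : ∀ γ ∈ Set.Icc lm lp, Integrable (fun ω => Real.exp (-γ * Y ω)) μ)
    (q : ℝ) (hq : q ∈ Set.Ioo (0 : ℝ) 1) :
    ∃ mm mp c : ℝ, lm ≤ mm ∧ mm ≤ 0 ∧ 0 ≤ mp ∧ mp ≤ lp ∧ mm < mp ∧ 0 < c ∧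
      ∀ ξ : ℂ, ξ.im ∈ Set.Icc mm mp →
        c ≤ (1 - (q : ℂ) * charFn μ Y ξ).re := by
  obtain ⟨hq0, hq1⟩ := hq
  have hia := hint lm ⟨le_rfl, hlt.le⟩
  have hib := hint lp ⟨hlt.le, le_rfl⟩
  set M : ℝ := ∫ ω, (Real.exp (-lm * Y ω) + Real.exp (-lp * Y ω)) ∂μ with hM
  have hM0 : 0 ≤ M := integral_nonneg fun ω => by positivity
  have hqM : 0 ≤ 2 * q * M := by positivity
  have hden : 0 < 1 - q + 2 * q * M := by linarith
  obtain ⟨t, ht0, ht1, htM⟩ : ∃ t : ℝ, 0 < t ∧ t ≤ 1 ∧ t * (2 * q * M) ≤ 1 - q := by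
    refine ⟨(1 - q) / (1 - q + 2 * q * M), div_pos (by linarith) hden,
      (div_le_one hden).2 (by linarith), ?_⟩
    rw [div_mul_eq_mul_div, div_le_iff₀ hden]
    exact mul_le_mul_of_nonneg_left (by linarith) (by linarith)
  refine ⟨t * lm, t * lp, (1 - q) / 2, by nlinarith, by nlinarith, by positivity, by nlinarith,
    by gcongr, by linarith, fun ξ hξ => ?_⟩
  have hξ' : ξ.im ∈ Set.Icc lm lp := ⟨by nlinarith [hξ.1], by nlinarith [hξ.2]⟩
  have hbound : ∫ ω, Real.exp (-ξ.im * Y ω) ∂μ ≤ 1 + t * M := by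
    have hsum : Integrable (fun ω => t * (Real.exp (-lm * Y ω) + Real.exp (-lp * Y ω))) μ :=
      (hia.add hib).const_mul t
    calc ∫ ω, Real.exp (-ξ.im * Y ω) ∂μ
        ≤ ∫ ω, (1 + t * (Real.exp (-lm * Y ω) + Real.exp (-lp * Y ω))) ∂μ :=
          integral_mono (hint _ hξ') ((integrable_const 1).add hsum)
            fun ω => exp_neg_mul_le_of_mem_Icc ht0.le ht1 hξ (Y ω)
      _ = 1 + t * M := by
          rw [integral_add (integrable_const 1) hsum, integral_const_mul]
          simp [hM]
  have hre : (charFn μ Y ξ).re ≤ 1 + t * M :=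
    (Complex.re_le_norm _).trans ((norm_charFn_le μ Y ξ).trans hbound)
  rw [Complex.sub_re, Complex.one_re, Complex.re_ofReal_mul]
  linarith [mul_le_mul_of_nonneg_left hre hq0.le]
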